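/- For every parameter θ = (μ, Σ, τ) with Σ symmetric positive definite and τ_i > 0 for all i, and all ξ, η, ζ ∈ T_θ, the Christoffel term Γ_θ satisfies the Koszul identity for constant vector fields: 2 g_θ(Γ_θ(ξ, η), ζ) = Dg(η, ζ)[ξ] + Dg(ξ, ζ)[η] − Dg(ξ, η)[ζ], where Dg(η, ζ)[ξ] denotes the directional derivative at θ in direction ξ of the map θ' ↦ g_{θ'}(η, ζ) with η, ζ held constant. In particular the connection ∇_ξ η = P_θ(Dη[ξ] + Γ_θ(ξ, η)) is compatible with the Fisher information metric. -/

import Mathlib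

open Matrix

noncomputable section

attribute [local instance] Matrix.normedAddCommGroup Matrix.normedSpace

abbrev E (p n : ℕ) : Type := (Fin p → ℝ) × Matrix (Fin p) (Fin p) ℝ × (Fin n → ℝ)

/-- Fisher information form at a parameter with scatter matrix `S` and textures `τ`. -/
def g (p n : ℕ) (S : Matrix (Fin p) (Fin p) ℝ) (τ : Fin n → ℝ) (ξ η : E p n) : ℝ :=
  (∑ i, (τ i)⁻¹) * (ξ.1 ⬝ᵥ (S⁻¹ *ᵥ η.1))
    + (n / 2 : ℝ) * (S⁻¹ * ξ.2.1ᵀ * S⁻¹ * η.2.1).trace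
    + (p / 2 : ℝ) * ∑ i, ξ.2.2 i * η.2.2 i / τ i ^ 2

/-- Tangent space at a parameter with textures `τ`. -/
def Tan (p n : ℕ) (τ : Fin n → ℝ) : Set (E p n) :=
  {ξ | ξ.2.1.IsSymm ∧ ∑ i, ξ.2.2 i / τ i = 0}

/-- Projection onto the tangent space. -/
def Pr (p n : ℕ) (τ : Fin n → ℝ) (ξ : E p n) : E p n :=
  (ξ.1, (1 / 2 : ℝ) • (ξ.2.1 + ξ.2.1ᵀ), ξ.2.2 - ((∑ i, ξ.2.2 i / τ i) / n) • τ)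

/-- Christoffel term. -/
def Gam (p n : ℕ) (S : Matrix (Fin p) (Fin p) ℝ) (τ : Fin n → ℝ) (ξ η : E p n) : E p n :=
  ((-(1 / 2) : ℝ) • (((∑ i, ξ.2.2 i / τ i ^ 2) / ∑ i, (τ i)⁻¹) • η.1
      + ((ξ.2.1 * S⁻¹) *ᵥ η.1)
      + ((∑ i, η.2.2 i / τ i ^ 2) / ∑ i, (τ i)⁻¹) • ξ.1
      + ((η.2.1 * S⁻¹) *ᵥ ξ.1)),
    ((∑ i, (τ i)⁻¹) / n) • vecMulVec η.1 ξ.1 - ξ.2.1 * S⁻¹ * η.2.1,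
    fun i => (1 / p : ℝ) * (ξ.1 ⬝ᵥ (S⁻¹ *ᵥ η.1)) - ξ.2.2 i * η.2.2 i / τ i)

section LinftyNorm

attribute [local instance] Matrix.linftyOpNormedRing Matrix.linftyOpNormedAlgebra

theorem hasFDerivAt_matrix_inv {p : ℕ} {S : Matrix (Fin p) (Fin p) ℝ} (hS : IsUnit S) :
    HasFDerivAt (fun A : Matrix (Fin p) (Fin p) ℝ => A⁻¹)
      (-(ContinuousLinearMap.mulLeftRight ℝ _ S⁻¹ S⁻¹)) S := by
  obtain ⟨u, rfl⟩ := hS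
  have : @CompleteSpace (Matrix (Fin p) (Fin p) ℝ)
      Matrix.linftyOpNormedRing.toMetricSpace.toUniformSpace :=
    @FiniteDimensional.complete ℝ (Matrix (Fin p) (Fin p) ℝ) _ _ _ _ _ _ _ _ _
  have h := hasFDerivAt_ringInverse (𝕜 := ℝ) u
  rw [show (Ring.inverse : Matrix (Fin p) (Fin p) ℝ → _) = fun A => A⁻¹ from
    funext fun A => (Matrix.nonsing_inv_eq_ringInverse A).symm, Matrix.coe_units_inv] at h
  exact h

theorem exists_hasFDerivAt_trace_inv_mul {p : ℕ} {S : Matrix (Fin p) (Fin p) ℝ} (hS : IsUnit S)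
    (A : Matrix (Fin p) (Fin p) ℝ) :
    ∃ L : Matrix (Fin p) (Fin p) ℝ →L[ℝ] ℝ,
      HasFDerivAt (fun M : Matrix (Fin p) (Fin p) ℝ => (M⁻¹ * A).trace) L S ∧
        ∀ X, L X = -(S⁻¹ * X * S⁻¹ * A).trace := by
  refine ⟨_, (LinearMap.toContinuousLinearMap
    (traceLinearMap (Fin p) ℝ ℝ)).hasFDerivAt.comp S ((hasFDerivAt_matrix_inv hS).mul_const' A), ?_⟩
  intro X
  change (-(S⁻¹ * X * S⁻¹) * A).trace = _
  rw [neg_mul, trace_neg]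

theorem exists_hasFDerivAt_trace_inv_mul_inv_mul {p : ℕ} {S : Matrix (Fin p) (Fin p) ℝ}
    (hS : IsUnit S) (A B : Matrix (Fin p) (Fin p) ℝ) :
    ∃ L : Matrix (Fin p) (Fin p) ℝ →L[ℝ] ℝ,
      HasFDerivAt (fun M : Matrix (Fin p) (Fin p) ℝ => (M⁻¹ * A * M⁻¹ * B).trace) L S ∧
        ∀ X, L X = -(S⁻¹ * X * S⁻¹ * A * S⁻¹ * B).trace
          - (S⁻¹ * A * S⁻¹ * X * S⁻¹ * B).trace := by
  refine ⟨_, (LinearMap.toContinuousLinearMap (traceLinearMap (Fin p) ℝ ℝ)).hasFDerivAt.comp S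
    ((((hasFDerivAt_matrix_inv hS).mul_const' A).mul' (hasFDerivAt_matrix_inv hS)).mul_const' B),
    ?_⟩
  intro X
  change ((S⁻¹ * A * -(S⁻¹ * X * S⁻¹) + -(S⁻¹ * X * S⁻¹) * A * S⁻¹) * B).trace = _
  simp only [add_mul, neg_mul, mul_neg, trace_add, trace_neg, ← mul_assoc]
  ring

end LinftyNorm

theorem exists_hasFDerivAt_sum_inv {n : ℕ} {τ : Fin n → ℝ} (hτ : ∀ i, τ i ≠ 0) :
    ∃ L : (Fin n → ℝ) →L[ℝ] ℝ,
      HasFDerivAt (fun t : Fin n → ℝ => ∑ i, (t i)⁻¹) L τ ∧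
        ∀ x, L x = -∑ i, x i / τ i ^ 2 := by
  refine ⟨_, HasFDerivAt.fun_sum fun i _ => (hasDerivAt_inv (hτ i)).comp_hasFDerivAt τ
    (ContinuousLinearMap.proj (R := ℝ) (φ := fun _ : Fin n => ℝ) i).hasFDerivAt, ?_⟩
  intro x
  simp [div_eq_inv_mul]

theorem exists_hasFDerivAt_sum_div_sq {n : ℕ} {τ : Fin n → ℝ} (hτ : ∀ i, τ i ≠ 0)
    (c : Fin n → ℝ) :
    ∃ L : (Fin n → ℝ) →L[ℝ] ℝ,
      HasFDerivAt (fun t : Fin n → ℝ => ∑ i, c i / t i ^ 2) L τ ∧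
        ∀ x, L x = -2 * ∑ i, c i * x i / τ i ^ 3 := by
  have h : ∀ i, HasDerivAt (fun s : ℝ => c i / s ^ 2) (-2 * c i / τ i ^ 3) (τ i) := fun i => by
    have := ((hasDerivAt_pow 2 (τ i)).inv (pow_ne_zero 2 (hτ i))).const_mul (c i)
    refine this.congr_deriv ?_
    have := hτ i
    simp
    field_simp
  refine ⟨_, HasFDerivAt.fun_sum (A := fun i (t : Fin n → ℝ) => c i / t i ^ 2)
    fun i _ => (h i).comp_hasFDerivAt τ (f := fun t : Fin n → ℝ => t i)
      (hasFDerivAt_apply i τ), ?_⟩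
  intro x
  simp only [_root_.sum_apply, _root_.smul_apply, ContinuousLinearMap.proj_apply, smul_eq_mul,
    Finset.mul_sum]
  refine Finset.sum_congr rfl fun i _ => ?_
  ring

theorem dotProduct_mulVec_eq_trace {p : ℕ} (M : Matrix (Fin p) (Fin p) ℝ) (u v : Fin p → ℝ) :
    u ⬝ᵥ (M *ᵥ v) = (M * vecMulVec v u).trace := by
  rw [mul_vecMulVec, trace_vecMulVec, dotProduct_comm]

theorem fderiv_g_apply {p n : ℕ} (μ : Fin p → ℝ) {S : Matrix (Fin p) (Fin p) ℝ} {τ : Fin n → ℝ}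
    (hS : IsUnit S) (hτ : ∀ i, τ i ≠ 0) (ξ η ζ : E p n) :
    fderiv ℝ (fun θ : E p n => g p n θ.2.1 θ.2.2 η ζ) (μ, S, τ) ξ =
      -(∑ i, ξ.2.2 i / τ i ^ 2) * (η.1 ⬝ᵥ (S⁻¹ *ᵥ ζ.1))
        - (∑ i, (τ i)⁻¹) * (η.1 ⬝ᵥ ((S⁻¹ * ξ.2.1 * S⁻¹) *ᵥ ζ.1))
        - (n / 2 : ℝ) * ((S⁻¹ * ξ.2.1 * S⁻¹ * η.2.1ᵀ * S⁻¹ * ζ.2.1).trace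
          + (S⁻¹ * η.2.1ᵀ * S⁻¹ * ξ.2.1 * S⁻¹ * ζ.2.1).trace)
        - p * ∑ i, η.2.2 i * ζ.2.2 i * ξ.2.2 i / τ i ^ 3 := by
  obtain ⟨L₁, h₁, e₁⟩ := exists_hasFDerivAt_sum_inv hτ
  obtain ⟨L₂, h₂, e₂⟩ := exists_hasFDerivAt_trace_inv_mul hS (vecMulVec ζ.1 η.1)
  obtain ⟨L₃, h₃, e₃⟩ := exists_hasFDerivAt_trace_inv_mul_inv_mul hS η.2.1ᵀ ζ.2.1
  obtain ⟨L₄, h₄, e₄⟩ := exists_hasFDerivAt_sum_div_sq hτ fun i => η.2.2 i * ζ.2.2 i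
  have hS' : HasFDerivAt (fun θ : E p n => θ.2.1) _ (μ, S, τ) :=
    (hasFDerivAt_snd (𝕜 := ℝ) (p := (μ, S, τ))).fst
  have hτ' : HasFDerivAt (fun θ : E p n => θ.2.2) _ (μ, S, τ) :=
    (hasFDerivAt_snd (𝕜 := ℝ) (p := (μ, S, τ))).snd
  have k₁ := h₁.comp (μ, S, τ) hτ'
  have k₂ := HasFDerivAt.comp (μ, S, τ) (f := fun θ : E p n => θ.2.1) h₂ hS'
  have k₃ := HasFDerivAt.comp (μ, S, τ) (f := fun θ : E p n => θ.2.1) h₃ hS'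
  have k₄ := h₄.comp (μ, S, τ) hτ'
  have key := ((k₁.mul k₂).add (k₃.const_mul (n / 2 : ℝ))).add (k₄.const_mul (p / 2 : ℝ))
  refine (DFunLike.congr_fun (key.congr_of_eventuallyEq
    (f₁ := fun θ : E p n => g p n θ.2.1 θ.2.2 η ζ)
    (.of_forall fun θ => by simp [g, dotProduct_mulVec_eq_trace])).fderiv ξ).trans ?_
  change (∑ i, (τ i)⁻¹) * L₂ ξ.2.1 + (S⁻¹ * vecMulVec ζ.1 η.1).trace * L₁ ξ.2.2
    + (n / 2 : ℝ) * L₃ ξ.2.1 + (p / 2 : ℝ) * L₄ ξ.2.2 = _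
  rw [e₁, e₂, e₃, e₄, dotProduct_mulVec_eq_trace, dotProduct_mulVec_eq_trace]
  ring

theorem trace_inv_mul_comm {p : ℕ} {T A B C : Matrix (Fin p) (Fin p) ℝ}
    (hT : T.IsSymm) (hA : A.IsSymm) (hB : B.IsSymm) (hC : C.IsSymm) :
    (T * A * T * B * T * C).trace = (T * B * T * A * T * C).trace := by
  rw [← trace_transpose]
  simp only [transpose_mul, hT.eq, hA.eq, hB.eq, hC.eq]
  rw [trace_mul_comm C]
  simp only [← mul_assoc]

theorem dotProduct_mulVec_comm_of_isSymm {p : ℕ} {M : Matrix (Fin p) (Fin p) ℝ} (hM : M.IsSymm)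
    (u v : Fin p → ℝ) : u ⬝ᵥ (M *ᵥ v) = v ⬝ᵥ (M *ᵥ u) := by
  rw [dotProduct_mulVec, ← mulVec_transpose, hM.eq, dotProduct_comm]

theorem g_Gam {p n : ℕ} (hp : 1 ≤ p) (hn : 1 ≤ n) {S : Matrix (Fin p) (Fin p) ℝ} {τ : Fin n → ℝ}
    (hS : S⁻¹.IsSymm) (hτ : ∀ i, 0 < τ i) {ξ η ζ : E p n} (hξ : ξ.2.1.IsSymm) (hη : η.2.1.IsSymm)
    (hζ : ζ.2.1.IsSymm) :
    2 * g p n S τ (Gam p n S τ ξ η) ζ =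
      -(∑ i, ξ.2.2 i / τ i ^ 2) * (η.1 ⬝ᵥ (S⁻¹ *ᵥ ζ.1))
        - (∑ i, η.2.2 i / τ i ^ 2) * (ξ.1 ⬝ᵥ (S⁻¹ *ᵥ ζ.1))
        + (∑ i, ζ.2.2 i / τ i ^ 2) * (ξ.1 ⬝ᵥ (S⁻¹ *ᵥ η.1))
        - (∑ i, (τ i)⁻¹) * (η.1 ⬝ᵥ ((S⁻¹ * ξ.2.1 * S⁻¹) *ᵥ ζ.1)
          + ξ.1 ⬝ᵥ ((S⁻¹ * η.2.1 * S⁻¹) *ᵥ ζ.1) - ξ.1 ⬝ᵥ ((S⁻¹ * ζ.2.1 * S⁻¹) *ᵥ η.1))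
        - n * (S⁻¹ * ξ.2.1 * S⁻¹ * η.2.1 * S⁻¹ * ζ.2.1).trace
        - p * ∑ i, ξ.2.2 i * η.2.2 i * ζ.2.2 i / τ i ^ 3 := by
  have hp' : (p : ℝ) ≠ 0 := by positivity
  have hn' : (n : ℝ) ≠ 0 := by positivity
  have hs : (∑ i, (τ i)⁻¹) ≠ 0 := by
    have : Nonempty (Fin n) := ⟨⟨0, hn⟩⟩
    exact (Finset.sum_pos (fun i _ => inv_pos.2 (hτ i)) Finset.univ_nonempty).ne'
  have move : ∀ (A : Matrix (Fin p) (Fin p) ℝ) (u : Fin p → ℝ), A.IsSymm →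
      ((A * S⁻¹) *ᵥ u) ⬝ᵥ (S⁻¹ *ᵥ ζ.1) = u ⬝ᵥ ((S⁻¹ * A * S⁻¹) *ᵥ ζ.1) := fun A u hA => by
    rw [← vecMul_transpose, ← dotProduct_mulVec, mulVec_mulVec, transpose_mul, hA.eq, hS.eq]
  have hμ : (∑ i, (τ i)⁻¹) * ((Gam p n S τ ξ η).1 ⬝ᵥ (S⁻¹ *ᵥ ζ.1)) = -(1 / 2) *
      ((∑ i, ξ.2.2 i / τ i ^ 2) * (η.1 ⬝ᵥ (S⁻¹ *ᵥ ζ.1))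
        + (∑ i, η.2.2 i / τ i ^ 2) * (ξ.1 ⬝ᵥ (S⁻¹ *ᵥ ζ.1))
        + (∑ i, (τ i)⁻¹) * (η.1 ⬝ᵥ ((S⁻¹ * ξ.2.1 * S⁻¹) *ᵥ ζ.1)
          + ξ.1 ⬝ᵥ ((S⁻¹ * η.2.1 * S⁻¹) *ᵥ ζ.1))) := by
    simp only [Gam, smul_dotProduct, add_dotProduct, move _ _ hξ, move _ _ hη, smul_eq_mul]
    generalize ∑ i, (τ i)⁻¹ = s at hs ⊢
    field_simp
    ring
  have hSig : (S⁻¹ * (Gam p n S τ ξ η).2.1ᵀ * S⁻¹ * ζ.2.1).trace =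
      (∑ i, (τ i)⁻¹) / n * (ξ.1 ⬝ᵥ ((S⁻¹ * ζ.2.1 * S⁻¹) *ᵥ η.1))
        - (S⁻¹ * ξ.2.1 * S⁻¹ * η.2.1 * S⁻¹ * ζ.2.1).trace := by
    have hV : (S⁻¹ * vecMulVec ξ.1 η.1 * S⁻¹ * ζ.2.1).trace =
        ξ.1 ⬝ᵥ ((S⁻¹ * ζ.2.1 * S⁻¹) *ᵥ η.1) := by
      have hM : (S⁻¹ * ζ.2.1 * S⁻¹).IsSymm := by
        simp [IsSymm, transpose_mul, hS.eq, hζ.eq, mul_assoc]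
      rw [dotProduct_mulVec_comm_of_isSymm hM, dotProduct_mulVec_eq_trace, mul_assoc,
        trace_mul_comm]
      simp only [mul_assoc]
    simp only [Gam, transpose_sub, transpose_smul, transpose_vecMulVec, transpose_mul, hS.eq,
      hξ.eq, hη.eq, mul_sub, sub_mul, mul_smul_comm, smul_mul_assoc, trace_sub, trace_smul, hV,
      smul_eq_mul, ← mul_assoc, trace_inv_mul_comm hS hη hξ hζ]
  have hT : ∑ i, (Gam p n S τ ξ η).2.2 i * ζ.2.2 i / τ i ^ 2 =
      1 / p * (ξ.1 ⬝ᵥ (S⁻¹ *ᵥ η.1)) * ∑ i, ζ.2.2 i / τ i ^ 2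
        - ∑ i, ξ.2.2 i * η.2.2 i * ζ.2.2 i / τ i ^ 3 := by
    rw [Finset.mul_sum, ← Finset.sum_sub_distrib]
    refine Finset.sum_congr rfl fun i _ => ?_
    have := (hτ i).ne'
    simp only [Gam]
    field_simp
  rw [g, hμ, hSig, hT]
  field_simp
  ring

/-- the Christoffel term satisfies the Koszul identity for constant
vector fields, so the associated connection is metric-compatible. -/
theorem stmt13 (p n : ℕ) (hp : 1 ≤ p) (hn : 1 ≤ n)
    (μ : Fin p → ℝ) (S : Matrix (Fin p) (Fin p) ℝ) (τ : Fin n → ℝ)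
    (hS : S.PosDef) (hτ : ∀ i, 0 < τ i) :
    ∀ ξ ∈ Tan p n τ, ∀ η ∈ Tan p n τ, ∀ ζ ∈ Tan p n τ,
      2 * g p n S τ (Gam p n S τ ξ η) ζ
        = fderiv ℝ (fun θ : E p n => g p n θ.2.1 θ.2.2 η ζ) (μ, S, τ) ξ
          + fderiv ℝ (fun θ : E p n => g p n θ.2.1 θ.2.2 ξ ζ) (μ, S, τ) η
          - fderiv ℝ (fun θ : E p n => g p n θ.2.1 θ.2.2 ξ η) (μ, S, τ) ζ := by
  intro ξ hξ η hη ζ hζ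
  have hU : IsUnit S := hS.isUnit
  have hτ₀ : ∀ i, τ i ≠ 0 := fun i => (hτ i).ne'
  have hT : S⁻¹.IsSymm := by
    have := hS.inv.isHermitian
    rwa [IsHermitian, conjTranspose_eq_transpose_of_trivial] at this
  have hc : ∑ i, η.2.2 i * ζ.2.2 i * ξ.2.2 i / τ i ^ 3 =
      ∑ i, ξ.2.2 i * η.2.2 i * ζ.2.2 i / τ i ^ 3 :=
    Finset.sum_congr rfl fun i _ => by ring
  have hc' : ∑ i, ξ.2.2 i * ζ.2.2 i * η.2.2 i / τ i ^ 3 =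
      ∑ i, ξ.2.2 i * η.2.2 i * ζ.2.2 i / τ i ^ 3 :=
    Finset.sum_congr rfl fun i _ => by ring
  have hcyc : (S⁻¹ * ζ.2.1 * S⁻¹ * ξ.2.1 * S⁻¹ * η.2.1).trace =
      (S⁻¹ * ξ.2.1 * S⁻¹ * η.2.1 * S⁻¹ * ζ.2.1).trace := by
    rw [mul_assoc (S⁻¹ * ζ.2.1 * S⁻¹ * ξ.2.1), mul_assoc (S⁻¹ * ζ.2.1), mul_assoc (S⁻¹ * ζ.2.1),
      trace_mul_comm]
    simp only [mul_assoc]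
  rw [g_Gam hp hn hT hτ hξ.1 hη.1 hζ.1, fderiv_g_apply μ hU hτ₀, fderiv_g_apply μ hU hτ₀,
    fderiv_g_apply μ hU hτ₀, hξ.1.eq, hη.1.eq, hc, hc',
    trace_inv_mul_comm hT hη.1 hξ.1 hζ.1, trace_inv_mul_comm hT hξ.1 hζ.1 hη.1, hcyc]
  ring
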